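/- The zero set of a 4-nomial in two variables in the positive quadrant has at most one compact connected component, and this bound is attained: the zero set of f(x₁,x₂) = x₂² − 4x₁³x₂ + x₁⁸ + 3x₁⁴ in ℝ_{>0}² is nonempty and compact. -/

import Mathlib

open Set Filter Topology

/-- A zero of a family of strictly increasing functions depends continuously on the parameter. -/
theorem continuous_of_strictMono_zero {X : Type*} [TopologicalSpace X] {F : X → ℝ → ℝ}
    (hF : ∀ t, Continuous fun x => F x t) (hmono : ∀ x, StrictMono (F x)) {τ : X → ℝ}
    (hτ : ∀ x, F x (τ x) = 0) : Continuous τ := by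
  refine continuous_iff_continuousAt.2 fun x => ?_
  refine tendsto_order.2 ⟨fun a ha => ?_, fun a ha => ?_⟩
  · have h : F x a < 0 := hτ x ▸ hmono x ha
    filter_upwards [(hF a).continuousAt.eventually_lt continuousAt_const h] with y hy
    exact (hmono y).lt_iff_lt.1 (by rwa [hτ y])
  · have h : 0 < F x a := hτ x ▸ hmono x ha
    filter_upwards [continuousAt_const.eventually_lt (hF a).continuousAt h] with y hy
    exact (hmono y).lt_iff_lt.1 (by rwa [hτ y])

/-- Every point of `Z` lies in an unbounded preconnected subset of `Z`. -/
def UnboundedThroughEveryPoint {E : Type*} [NormedAddCommGroup E] (Z : Set E) : Prop :=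
  ∀ z ∈ Z, ∃ S ⊆ Z, z ∈ S ∧ IsPreconnected S ∧ ¬ Bornology.IsBounded S

section ExpSum

variable {E ι : Type*} [NormedAddCommGroup E] [NormedSpace ℝ E] [Fintype ι]

theorem unboundedThroughEveryPoint_of_line {Z : Set E} {v : E} (hv : v ≠ 0)
    (h : ∀ z ∈ Z, ∀ s : ℝ, z + s • v ∈ Z) : UnboundedThroughEveryPoint Z := by
  intro z hz
  refine ⟨range fun s : ℝ => z + s • v, ?_, ⟨0, by simp⟩,
    isPreconnected_range (by fun_prop), fun hb => ?_⟩
  · rintro _ ⟨s, rfl⟩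
    exact h z hz s
  · obtain ⟨C, hC⟩ := hb.exists_norm_le
    have hv' : 0 < ‖v‖ := norm_pos_iff.2 hv
    have h1 := hC _ ⟨(C + ‖z‖ + 1) / ‖v‖, rfl⟩
    have hC0 : 0 ≤ C := (norm_nonneg _).trans h1
    have h2 : ‖((C + ‖z‖ + 1) / ‖v‖) • v‖ = C + ‖z‖ + 1 := by
      rw [norm_smul, Real.norm_of_nonneg (by positivity), div_mul_cancel₀ _ hv'.ne']
    have h3 := norm_sub_le (z + ((C + ‖z‖ + 1) / ‖v‖) • v) z
    rw [add_sub_cancel_left, h2] at h3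
    simp only at h1
    linarith

/-- The exponential sum `∑ pᵢ exp (bᵢ u)` with real exponent functionals `bᵢ`. -/
noncomputable def expSum (p : ι → ℝ) (b : ι → E →L[ℝ] ℝ) (u : E) : ℝ :=
  ∑ i, p i * Real.exp (b i u)

variable {p : ι → ℝ} {b : ι → E →L[ℝ] ℝ}

theorem continuous_expSum : Continuous (expSum p b) := by
  unfold expSum
  fun_prop

theorem convexOn_expSum (hp : ∀ i, 0 < p i) : ConvexOn ℝ univ (expSum p b) := by
  refine ⟨convex_univ, fun x _ y _ s t hs ht hst => ?_⟩
  simp only [expSum, smul_eq_mul, Finset.mul_sum, ← Finset.sum_add_distrib]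
  refine Finset.sum_le_sum fun i _ => ?_
  have h := convexOn_exp.2 (mem_univ (b i x)) (mem_univ (b i y)) hs ht hst
  simp only [smul_eq_mul] at h
  simp only [map_add, map_smul, smul_eq_mul]
  nlinarith [mul_le_mul_of_nonneg_left h (hp i).le]

/-- Along a direction in which no exponent increases and some exponent strictly decreases,
the level sets of an exponential sum are graphs, hence preconnected. -/
theorem isPreconnected_level_of_nonpos (hp : ∀ i, 0 < p i) (q : ℝ) {v : E}
    (hv : ∀ i, b i v ≤ 0) {j : ι} (hj : b j v < 0) :
    IsPreconnected {u | expSum p b u = q} := by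
  have hmono : ∀ w, StrictMono fun t : ℝ => expSum p b (w - t • v) := by
    intro w s t hst
    refine Finset.sum_lt_sum (fun i _ => ?_) ⟨j, Finset.mem_univ j, ?_⟩
    · refine mul_le_mul_of_nonneg_left (Real.exp_le_exp.2 ?_) (hp i).le
      simp only [map_sub, map_smul, smul_eq_mul]
      nlinarith [hv i]
    · refine mul_lt_mul_of_pos_left (Real.exp_lt_exp.2 ?_) (hp j)
      simp only [map_sub, map_smul, smul_eq_mul]
      nlinarith
  have hlarge : ∀ w, ∃ t : ℝ, q ≤ expSum p b (w - t • v) := by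
    intro w
    refine ⟨(b j w - q / p j) / b j v, ?_⟩
    have h1 : q ≤ p j * Real.exp (b j (w - ((b j w - q / p j) / b j v) • v)) := by
      have h2 : b j (w - ((b j w - q / p j) / b j v) • v) = q / p j := by
        simp only [map_sub, map_smul, smul_eq_mul]
        field_simp [hj.ne]
        ring
      have h3 := Real.add_one_le_exp (q / p j)
      rw [h2]
      calc q = p j * (q / p j) := by field_simp [(hp j).ne']
        _ ≤ _ := mul_le_mul_of_nonneg_left (by linarith) (hp j).le
    exact h1.trans (Finset.single_le_sum (f := fun i => p i * Real.exp (b i _))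
      (fun i _ => mul_nonneg (hp i).le (Real.exp_pos _).le) (Finset.mem_univ j))
  refine isPreconnected_of_forall_pair fun x hx y hy => ?_
  have hseg : ∀ w : segment ℝ x y, ∃ t : ℝ, expSum p b (w - t • v) = q := by
    rintro ⟨w, hw⟩
    have hle : expSum p b w ≤ q :=
      (((convexOn_expSum hp).convex_le q).segment_subset ⟨mem_univ x, le_of_eq hx⟩
        ⟨mem_univ y, le_of_eq hy⟩ hw).2
    have hc : Continuous fun t : ℝ => expSum p b (w - t • v) :=
      continuous_expSum.comp (by fun_prop)
    exact mem_range_of_exists_le_of_exists_ge hc ⟨0, by simpa using hle⟩ (hlarge w)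
  choose τ hτ using hseg
  have hτc : Continuous τ := continuous_of_strictMono_zero
    (F := fun (w : segment ℝ x y) t => expSum p b (w - t • v) - q)
    (fun t => (continuous_expSum.comp (by fun_prop)).sub continuous_const)
    (fun w s t hst => sub_lt_sub_right (hmono w hst) q) (fun w => sub_eq_zero.2 (hτ w))
  have hfix : ∀ w (hw : w ∈ segment ℝ x y), expSum p b w = q →
      w ∈ range fun w : segment ℝ x y => (w : E) - τ w • v := by
    intro w hw h
    have h0 : τ ⟨w, hw⟩ = 0 := (hmono w).injective (by simpa [h] using hτ ⟨w, hw⟩)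
    exact ⟨⟨w, hw⟩, by simp [h0]⟩
  have : PreconnectedSpace (segment ℝ x y) :=
    Subtype.preconnectedSpace (convex_segment x y).isPreconnected
  refine ⟨range fun w : segment ℝ x y => (w : E) - τ w • v, ?_,
    hfix x (left_mem_segment ℝ x y) hx, hfix y (right_mem_segment ℝ x y) hy,
    isPreconnected_range (by fun_prop)⟩
  rintro _ ⟨w, rfl⟩
  exact hτ w

theorem isBounded_sublevel_of_forall_exists_pos [FiniteDimensional ℝ E] [Nontrivial E]
    (hp : ∀ i, 0 < p i) (q : ℝ) (h : ∀ v ≠ 0, ∃ i, 0 < b i v) :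
    Bornology.IsBounded {u | expSum p b u ≤ q} := by
  have := FiniteDimensional.proper ℝ E
  obtain ⟨v₀, hv₀, hmin⟩ := (isCompact_sphere (0 : E) 1).exists_isMinOn
    (NormedSpace.sphere_nonempty.2 zero_le_one)
    (f := fun u => ∑ i, max (b i u) 0) (by fun_prop)
  have hpos : 0 < ∑ i, max (b i v₀) 0 := by
    obtain ⟨i, hi⟩ := h v₀ (ne_zero_of_mem_unit_sphere ⟨v₀, hv₀⟩)
    exact Finset.sum_pos' (fun _ _ => le_max_right _ _) ⟨i, Finset.mem_univ i, lt_max_of_lt_left hi⟩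
  refine isBounded_iff_forall_norm_le.2
    ⟨(∑ i, max (q / p i) 0) / ∑ i, max (b i v₀) 0, fun u hu => ?_⟩
  rcases eq_or_ne u 0 with rfl | hu0
  · rw [norm_zero]
    exact div_nonneg (Finset.sum_nonneg fun _ _ => le_max_right _ _) hpos.le
  have hn : 0 < ‖u‖ := norm_pos_iff.2 hu0
  have h1 := isMinOn_iff.1 hmin (‖u‖⁻¹ • u) (by simp [norm_smul, hn.ne'])
  have h2 : ∑ i, max (b i (‖u‖⁻¹ • u)) 0 = ‖u‖⁻¹ * ∑ i, max (b i u) 0 := by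
    rw [Finset.mul_sum]
    refine Finset.sum_congr rfl fun i _ => ?_
    rw [map_smul, smul_eq_mul, mul_max_of_nonneg _ _ (inv_nonneg.2 hn.le), mul_zero]
  rw [h2, le_inv_mul_iff₀ hn] at h1
  rw [le_div_iff₀ hpos]
  refine h1.trans (Finset.sum_le_sum fun i _ => max_le_max_right 0 ?_)
  rw [le_div_iff₀ (hp i)]
  have h3 : p i * Real.exp (b i u) ≤ q :=
    (Finset.single_le_sum (f := fun i => p i * Real.exp (b i u))
      (fun i _ => mul_nonneg (hp i).le (Real.exp_pos _).le) (Finset.mem_univ i)).trans hu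
  nlinarith [Real.add_one_le_exp (b i u), hp i]

theorem frontier_sublevel_expSum (hp : ∀ i, 0 < p i) {q : ℝ} {u₀ : E} (h₀ : expSum p b u₀ < q) :
    frontier {u | expSum p b u ≤ q} = {u | expSum p b u = q} := by
  refine Subset.antisymm (frontier_le_subset_eq continuous_expSum continuous_const) fun u hu => ?_
  have hu : expSum p b u = q := hu
  refine ⟨subset_closure hu.le, fun hint => ?_⟩
  have hc : Tendsto (fun t : ℝ => u + t • (u - u₀)) (𝓝[>] 0) (𝓝 u) := by
    have : Continuous fun t : ℝ => u + t • (u - u₀) := by fun_prop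
    simpa using (this.tendsto 0).mono_left nhdsWithin_le_nhds
  obtain ⟨t, ht, ht0⟩ := ((hc.eventually (mem_interior_iff_mem_nhds.1 hint)).and
    self_mem_nhdsWithin).exists
  have ht : expSum p b (u + t • (u - u₀)) ≤ q := ht
  have ht0 : 0 < t := ht0
  have hs1 : 0 ≤ t / (1 + t) := by positivity
  have hs2 : 0 ≤ 1 / (1 + t) := by positivity
  have h1 := (convexOn_expSum (b := b) hp).2 (mem_univ u₀) (mem_univ (u + t • (u - u₀)))
    hs1 hs2 (by field_simp; ring)
  have h2 : (t / (1 + t)) • u₀ + (1 / (1 + t)) • (u + t • (u - u₀)) = u := by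
    match_scalars <;> field_simp
    ring
  rw [h2, hu, smul_eq_mul, smul_eq_mul] at h1
  have h3 : t / (1 + t) * expSum p b u₀ < t / (1 + t) * q :=
    mul_lt_mul_of_pos_left h₀ (by positivity)
  have h4 : 1 / (1 + t) * expSum p b (u + t • (u - u₀)) ≤ 1 / (1 + t) * q :=
    mul_le_mul_of_nonneg_left ht (by positivity)
  have h5 : t / (1 + t) * q + 1 / (1 + t) * q = q := by field_simp; ring
  linarith

/-- A level set of an exponential sum with positive coefficients is preconnected, or it is
unbounded through every point. -/
theorem level_expSum_dichotomy [FiniteDimensional ℝ E] (hE : 1 < Module.rank ℝ E)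
    (hp : ∀ i, 0 < p i) (q : ℝ) :
    IsPreconnected {u | expSum p b u = q} ∨
      UnboundedThroughEveryPoint {u | expSum p b u = q} := by
  by_cases h : ∃ v ≠ 0, ∀ i, b i v ≤ 0
  · obtain ⟨v, hv0, hv⟩ := h
    by_cases hz : ∀ i, b i v = 0
    · refine .inr (unboundedThroughEveryPoint_of_line hv0 fun z hz' s => ?_)
      simpa [expSum, hz] using hz'
    · push Not at hz
      obtain ⟨j, hj⟩ := hz
      exact .inl (isPreconnected_level_of_nonpos hp q hv ((hv j).lt_of_ne hj))
  push Not at h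
  left
  have : Nontrivial E := (rank_pos_iff_nontrivial (R := ℝ)).1 (zero_lt_one.trans hE)
  have hconv : Convex ℝ {u | expSum p b u ≤ q} := by
    simpa using (convexOn_expSum (b := b) hp).convex_le q
  by_cases h₀ : ∃ u₀, expSum p b u₀ < q
  · obtain ⟨u₀, h₀⟩ := h₀
    have hint : (interior {u | expSum p b u ≤ q}).Nonempty :=
      ⟨u₀, interior_maximal (fun u hu => le_of_lt hu)
        (isOpen_lt continuous_expSum continuous_const) h₀⟩
    obtain ⟨e, -, -, he⟩ := exists_homeomorph_image_interior_closure_frontier_eq_unitBall hconv hint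
      (isBounded_sublevel_of_forall_exists_pos hp q h)
    rw [← frontier_sublevel_expSum hp h₀, ← e.isPreconnected_image, he]
    exact isPreconnected_sphere hE 0 1
  · push Not at h₀
    convert hconv.isPreconnected using 1
    ext u
    exact ⟨fun hu => le_of_eq hu, fun hu => le_antisymm hu (h₀ u)⟩

end ExpSum

/-- A continuous function increasing to infinity on a half-line has a continuous right inverse
there. -/
theorem exists_continuous_rightInverse_Ici {f : ℝ → ℝ} (hf : Continuous f)
    (hmono : StrictMonoOn f (Ici 0)) (htop : Tendsto f atTop atTop) :
    ∃ h : ℝ → ℝ, Continuous h ∧ h (f 0) = 0 ∧ ∀ r, f 0 ≤ r → f (h r) = r := by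
  have hext : StrictMono fun t : ℝ => f (max t 0) + min t 0 := by
    intro s t hst
    rcases le_or_gt 0 s with hs | hs
    · simpa [hs, hs.trans hst.le] using hmono hs (hs.trans hst.le) hst
    · have h1 : f (max s 0) ≤ f (max t 0) :=
        hmono.monotoneOn (mem_Ici.2 (le_max_right _ _)) (mem_Ici.2 (le_max_right _ _))
          (max_le_max_right 0 hst.le)
      have h2 : min s 0 < min t 0 := by
        rw [min_eq_left hs.le]
        exact lt_min hst hs
      exact add_lt_add_of_le_of_lt h1 h2
  have hcont : Continuous fun t : ℝ => f (max t 0) + min t 0 := by fun_prop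
  have hsurj : ∀ r, ∃ t : ℝ, f (max t 0) + min t 0 = r := by
    intro r
    refine mem_range_of_exists_le_of_exists_ge hcont ⟨min 0 (r - f 0), ?_⟩ ?_
    · have h1 := min_le_right 0 (r - f 0)
      have h2 := min_le_left 0 (r - f 0)
      simp only [max_eq_right h2, min_eq_left h2]
      linarith
    · obtain ⟨t, h1, h2⟩ := ((htop.eventually_ge_atTop r).and (eventually_ge_atTop 0)).exists
      exact ⟨t, by simpa [h2] using h1⟩
  choose h hh using hsurj
  have h0 : h (f 0) = 0 := hext.injective (by simpa using hh (f 0))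
  refine ⟨h, continuous_of_strictMono_zero (F := fun r t => f (max t 0) + min t 0 - r)
    (fun t => by fun_prop) (fun r s t hst => sub_lt_sub_right (hext hst) r)
    (fun r => sub_eq_zero.2 (hh r)), h0, fun r hr => ?_⟩
  have h1 : 0 ≤ h r := hext.le_iff_le.1 (by simpa [hh r] using hr)
  simpa [h1] using hh r

/-- A sum of two exponentials whose exponents differ by one increases to infinity on at least one
of the two half-lines. -/
theorem exists_sign_strictMonoOn_exp_add_exp {p₁ p₂ : ℝ} (h₁ : 0 < p₁) (h₂ : 0 < p₂) (α : ℝ) :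
    ∃ ε : ℝ, ε ≠ 0 ∧
      StrictMonoOn (fun s => p₁ * Real.exp (α * (ε * s)) + p₂ * Real.exp ((α - 1) * (ε * s)))
        (Ici 0) ∧
      Tendsto (fun s => p₁ * Real.exp (α * (ε * s)) + p₂ * Real.exp ((α - 1) * (ε * s)))
        atTop atTop := by
  have key : ∀ {p₁ p₂ : ℝ}, 0 < p₁ → 0 < p₂ → ∀ α : ℝ, 0 ≤ p₁ * α + p₂ * (α - 1) →
      StrictMonoOn (fun s => p₁ * Real.exp (α * s) + p₂ * Real.exp ((α - 1) * s)) (Ici 0) ∧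
      Tendsto (fun s => p₁ * Real.exp (α * s) + p₂ * Real.exp ((α - 1) * s)) atTop atTop := by
    intro p₁ p₂ h₁ h₂ α hα
    have hα0 : 0 < α := by
      by_contra! h
      nlinarith
    constructor
    · refine strictMonoOn_of_deriv_pos (convex_Ici 0) (by fun_prop) fun s hs => ?_
      rw [interior_Ici] at hs
      have hd : HasDerivAt (fun s => p₁ * Real.exp (α * s) + p₂ * Real.exp ((α - 1) * s))
          (p₁ * (Real.exp (α * s) * (α * 1)) +
            p₂ * (Real.exp ((α - 1) * s) * ((α - 1) * 1))) s :=
        ((((hasDerivAt_id s).const_mul α).exp).const_mul p₁).add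
          ((((hasDerivAt_id s).const_mul (α - 1)).exp).const_mul p₂)
      have he : Real.exp (α * s) = Real.exp ((α - 1) * s) * Real.exp s := by
        rw [← Real.exp_add]
        ring_nf
      have h3 : p₁ * (Real.exp (α * s) * (α * 1)) +
          p₂ * (Real.exp ((α - 1) * s) * ((α - 1) * 1)) =
          Real.exp ((α - 1) * s) * (p₁ * α * (Real.exp s - 1) + (p₁ * α + p₂ * (α - 1))) := by
        rw [he]
        ring
      have h4 : 0 < Real.exp s - 1 := by linarith [Real.add_one_lt_exp hs.ne', show 0 < s from hs]
      rw [hd.deriv, h3]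
      positivity
    · refine tendsto_atTop_mono (f := fun s => p₁ * Real.exp (α * s))
        (fun s => le_add_of_nonneg_right (by positivity)) ?_
      exact (Real.tendsto_exp_atTop.comp (tendsto_id.const_mul_atTop hα0)).const_mul_atTop h₁
  rcases le_total 0 (p₁ * α + p₂ * (α - 1)) with h | h
  · exact ⟨1, one_ne_zero, by simpa using key h₁ h₂ α h⟩
  · refine ⟨-1, by norm_num, ?_⟩
    have h5 := key h₂ h₁ (1 - α) (by linarith)
    convert h5 using 2 <;> · funext s; ring_nf

/-- The linear functional `u ↦ a₁ u₁ + a₂ u₂` on the plane. -/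
noncomputable def dotCLM (a : ℝ × ℝ) : ℝ × ℝ →L[ℝ] ℝ :=
  a.1 • ContinuousLinearMap.fst ℝ ℝ ℝ + a.2 • ContinuousLinearMap.snd ℝ ℝ ℝ

@[simp]
theorem dotCLM_apply (a u : ℝ × ℝ) : dotCLM a u = a.1 * u.1 + a.2 * u.2 := rfl

/-- Coordinates on the plane given by two linearly independent functionals. -/
theorem exists_dual_basis {A B : ℝ × ℝ} (h : A.1 * B.2 - A.2 * B.1 ≠ 0) :
    ∃ P Q : ℝ × ℝ, dotCLM A P = 1 ∧ dotCLM A Q = 0 ∧ dotCLM B P = 0 ∧ dotCLM B Q = 1 ∧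
      Q = (A.1 * B.2 - A.2 * B.1)⁻¹ • (-A.2, A.1) := by
  refine ⟨(A.1 * B.2 - A.2 * B.1)⁻¹ • (B.2, -B.1), (A.1 * B.2 - A.2 * B.1)⁻¹ • (-A.2, A.1),
    ?_, ?_, ?_, ?_, rfl⟩
  · simp; field_simp; ring
  · simp; ring
  · simp; ring
  · rw [map_smul, smul_eq_mul, inv_mul_eq_one₀ h, dotCLM_apply]
    ring

/-- The image of an unbounded curve, seen through a linear functional. -/
theorem not_isBounded_image_Ici {γ : ℝ → ℝ × ℝ} {A : ℝ × ℝ} {ε k : ℝ} (hε : ε ≠ 0)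
    (h : ∀ s, dotCLM A (γ s) = k + ε * s) : ¬ Bornology.IsBounded (γ '' Ici 0) := by
  intro hb
  obtain ⟨C, hC⟩ := ((dotCLM A).lipschitz.isBounded_image hb).exists_norm_le
  have hC0 : 0 ≤ C := (norm_nonneg _).trans (hC _ ⟨_, ⟨0, self_mem_Ici, rfl⟩, rfl⟩)
  have h1 := hC _ ⟨_, ⟨(C + |k| + 1) / |ε|, mem_Ici.2 (by positivity), rfl⟩, rfl⟩
  rw [h, Real.norm_eq_abs] at h1
  have h2 : |ε * ((C + |k| + 1) / |ε|)| = C + |k| + 1 := by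
    rw [abs_mul, abs_div, abs_abs, mul_div_cancel₀ _ (abs_ne_zero.2 hε)]
    exact abs_of_nonneg (by positivity)
  have h3 := abs_sub (k + ε * ((C + |k| + 1) / |ε|)) k
  rw [add_sub_cancel_left, h2] at h3
  linarith

/-- Two positive binomials agree along unbounded curves through any of their common values. -/
theorem unboundedThroughEveryPoint_two_add_two {p₁ p₂ p₃ p₄ : ℝ} (h₁ : 0 < p₁) (h₂ : 0 < p₂)
    (h₃ : 0 < p₃) (h₄ : 0 < p₄) {a₁ a₂ a₃ a₄ : ℝ × ℝ} (h₁₂ : a₁ ≠ a₂) :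
    UnboundedThroughEveryPoint {u : ℝ × ℝ |
      p₁ * Real.exp (dotCLM a₁ u) + p₂ * Real.exp (dotCLM a₂ u) =
        p₃ * Real.exp (dotCLM a₃ u) + p₄ * Real.exp (dotCLM a₄ u)} := by
  obtain ⟨A, hA⟩ : ∃ A, A = a₁ - a₂ := ⟨_, rfl⟩
  obtain ⟨B, hB⟩ : ∃ B, B = a₃ - a₄ := ⟨_, rfl⟩
  obtain ⟨W, hW⟩ : ∃ W, W = a₄ - a₂ := ⟨_, rfl⟩
  obtain rfl : a₁ = a₂ + A := by rw [hA]; abel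
  obtain rfl : a₄ = a₂ + W := by rw [hW]; abel
  obtain rfl : a₃ = a₂ + W + B := by rw [hB]; abel
  clear hA hB hW
  have hA0 : A ≠ 0 := by simpa using h₁₂
  have hfactor : ∀ u : ℝ × ℝ,
      (p₁ * Real.exp (dotCLM (a₂ + A) u) + p₂ * Real.exp (dotCLM a₂ u) =
        p₃ * Real.exp (dotCLM (a₂ + W + B) u) + p₄ * Real.exp (dotCLM (a₂ + W) u)) ↔
      p₁ * Real.exp (dotCLM A u) + p₂ =
        Real.exp (dotCLM W u) * (p₃ * Real.exp (dotCLM B u) + p₄) := by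
    intro u
    have e1 : dotCLM (a₂ + A) u = dotCLM a₂ u + dotCLM A u := by simp; ring
    have e2 : dotCLM (a₂ + W) u = dotCLM a₂ u + dotCLM W u := by simp; ring
    have e3 : dotCLM (a₂ + W + B) u = dotCLM a₂ u + dotCLM W u + dotCLM B u := by simp; ring
    rw [e1, e2, e3, Real.exp_add, Real.exp_add, Real.exp_add,
      ← mul_right_inj' (a := Real.exp (dotCLM a₂ u)) (b := p₁ * _ + p₂)
        (Real.exp_pos _).ne']
    constructor <;> intro h <;> linarith
  simp only [hfactor]
  by_cases hAB : A.1 * B.2 - A.2 * B.1 = 0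
  · by_cases hAW : A.1 * W.2 - A.2 * W.1 = 0
    · refine unboundedThroughEveryPoint_of_line (v := (-A.2, A.1)) ?_ fun z hz s => ?_
      · intro h
        simp only [Prod.mk_eq_zero, neg_eq_zero] at h
        exact hA0 (Prod.ext h.2 h.1)
      · have e : ∀ C : ℝ × ℝ, A.1 * C.2 - A.2 * C.1 = 0 →
            dotCLM C (z + s • (-A.2, A.1)) = dotCLM C z := by
          intro C hC
          simp only [dotCLM_apply, Prod.fst_add, Prod.snd_add, Prod.smul_fst, Prod.smul_snd,
            smul_eq_mul]
          linear_combination s * hC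
        simpa only [mem_ofPred_eq, e A (by ring), e B hAB, e W hAW] using hz
    · obtain ⟨P, Q, hAP, hAQ, hWP, hWQ, hQ⟩ := exists_dual_basis hAW
      have hBQ : dotCLM B Q = 0 := by
        rw [hQ, map_smul]
        simp only [dotCLM_apply, smul_eq_mul]
        linear_combination (A.1 * W.2 - A.2 * W.1)⁻¹ * hAB
      intro z hz
      have hz : p₁ * Real.exp (dotCLM A z) + p₂ =
        Real.exp (dotCLM W z) * (p₃ * Real.exp (dotCLM B z) + p₄) := hz
      obtain ⟨τ, hτ⟩ : ∃ τ : ℝ → ℝ, τ = fun s =>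
        Real.log ((p₁ * Real.exp (dotCLM A z + s) + p₂) /
          (p₃ * Real.exp (dotCLM B z + dotCLM B P * s) + p₄)) - dotCLM W z := ⟨_, rfl⟩
      have hτc : Continuous τ := by
        rw [hτ]
        refine Continuous.sub (Continuous.log (Continuous.div (by fun_prop) (by fun_prop) ?_) ?_)
          continuous_const
        · intro s; positivity
        · intro s; positivity
      have hτ0 : τ 0 = 0 := by
        rw [hτ]
        simp only [add_zero, mul_zero]
        rw [hz, mul_div_cancel_right₀ _ (by positivity), Real.log_exp, sub_self]
      have hγ : ∀ C s, dotCLM C (z + s • P + τ s • Q) =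
          dotCLM C z + s * dotCLM C P + τ s * dotCLM C Q := by
        intro C s
        simp only [map_add, map_smul, smul_eq_mul]
      refine ⟨(fun s : ℝ => z + s • P + τ s • Q) '' Ici 0, ?_, ⟨0, self_mem_Ici, by simp [hτ0]⟩,
        isPreconnected_Ici.image _ (by fun_prop),
        not_isBounded_image_Ici one_ne_zero (A := A) (k := dotCLM A z) fun s => ?_⟩
      · rintro _ ⟨s, -, rfl⟩
        simp only [mem_ofPred_eq, hγ, hAP, hAQ, hWP, hWQ, hBQ, mul_zero, mul_one, add_zero]
        have e : dotCLM W z + τ s = Real.log ((p₁ * Real.exp (dotCLM A z + s) + p₂) /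
          (p₃ * Real.exp (dotCLM B z + dotCLM B P * s) + p₄)) := by
          rw [hτ]
          ring
        rw [e, Real.exp_log (by positivity), mul_comm s]
        field_simp
      · rw [hγ, hAP, hAQ]
        ring
  · obtain ⟨P, Q, hAP, hAQ, hBP, hBQ, -⟩ := exists_dual_basis hAB
    obtain ⟨α, hα⟩ : ∃ α, α = dotCLM W P := ⟨_, rfl⟩
    obtain ⟨β, hβ⟩ : ∃ β, β = dotCLM W Q := ⟨_, rfl⟩
    intro z hz
    have hz : p₁ * Real.exp (dotCLM A z) + p₂ =
      Real.exp (dotCLM W z) * (p₃ * Real.exp (dotCLM B z) + p₄) := hz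
    obtain ⟨ε, hε, hmono, -⟩ := exists_sign_strictMonoOn_exp_add_exp
      (p₁ := p₁ * Real.exp (dotCLM A z)) (p₂ := p₂) (by positivity) h₂ (1 - α)
    obtain ⟨δ, hδ, hmono', htop'⟩ := exists_sign_strictMonoOn_exp_add_exp
      (p₁ := Real.exp (dotCLM W z) * (p₃ * Real.exp (dotCLM B z)))
      (p₂ := Real.exp (dotCLM W z) * p₄) (by positivity) (by positivity) (1 + β)
    obtain ⟨h, hc, h0, hh⟩ := exists_continuous_rightInverse_Ici (by fun_prop) hmono' htop'
    obtain ⟨Φ, hΦ⟩ : ∃ Φ : ℝ → ℝ, Φ = fun s => p₁ * Real.exp (dotCLM A z) *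
      Real.exp ((1 - α) * (ε * s)) + p₂ * Real.exp ((1 - α - 1) * (ε * s)) := ⟨_, rfl⟩
    rw [← hΦ] at hmono
    simp only [mul_zero, Real.exp_zero, mul_one] at h0 hh
    have hΦ0 : Φ 0 = Real.exp (dotCLM W z) * (p₃ * Real.exp (dotCLM B z)) +
        Real.exp (dotCLM W z) * p₄ := by
      rw [hΦ]
      simp only [mul_zero, Real.exp_zero, mul_one]
      linarith
    have hΦc : Continuous Φ := by
      rw [hΦ]
      fun_prop
    have hγ : ∀ C s, dotCLM C (z + (ε * s) • P + (δ * h (Φ s)) • Q) =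
        dotCLM C z + ε * s * dotCLM C P + δ * h (Φ s) * dotCLM C Q := by
      intro C s
      simp only [map_add, map_smul, smul_eq_mul]
    refine ⟨(fun s : ℝ => z + (ε * s) • P + (δ * h (Φ s)) • Q) '' Ici 0, ?_,
      ⟨0, self_mem_Ici, by simp only [hΦ0, h0]; simp⟩, isPreconnected_Ici.image _ (by fun_prop),
      not_isBounded_image_Ici hε (A := A) (k := dotCLM A z) fun s => ?_⟩
    · rintro _ ⟨s, hs, rfl⟩
      simp only [mem_ofPred_eq, hγ, hAP, hAQ, hBP, hBQ, mul_zero, mul_one, add_zero, ← hα, ← hβ]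
      have h5 := hh (Φ s) (hΦ0 ▸ hmono.monotoneOn self_mem_Ici hs hs)
      generalize h (Φ s) = t at h5 ⊢
      rw [hΦ] at h5
      have e1 : (1 - α) * (ε * s) = ε * s + -(ε * s * α) := by ring
      have e2 : (1 - α - 1) * (ε * s) = -(ε * s * α) := by ring
      have e3 : (1 + β) * (δ * t) = δ * t + δ * t * β := by ring
      have e4 : (1 + β - 1) * (δ * t) = δ * t * β := by ring
      simp only [e1, e2, e3, e4, Real.exp_add, Real.exp_neg] at h5 ⊢
      field_simp at h5
      linear_combination -h5
    · rw [hγ, hAP, hAQ]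
      ring

/-- The zero set of a four-term exponential sum in the plane is preconnected, or none of its
points lies in a bounded connected component. -/
theorem isPreconnected_or_unboundedThroughEveryPoint {c : Fin 4 → ℝ} {a : Fin 4 → ℝ × ℝ}
    (hc : ∀ i, c i ≠ 0) (ha : Function.Injective a) :
    IsPreconnected {u | ∑ i, c i * Real.exp (dotCLM (a i) u) = 0} ∨
      UnboundedThroughEveryPoint {u | ∑ i, c i * Real.exp (dotCLM (a i) u) = 0} := by
  have key13 : ∀ {d₀ d₁ d₂ d₃ : ℝ} {a₀ a₁ a₂ a₃ : ℝ × ℝ} {Z : Set (ℝ × ℝ)},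
      0 < d₁ → 0 < d₂ → 0 < d₃ →
      (∀ u, u ∈ Z ↔ d₁ * Real.exp (dotCLM a₁ u) + d₂ * Real.exp (dotCLM a₂ u) +
        d₃ * Real.exp (dotCLM a₃ u) + d₀ * Real.exp (dotCLM a₀ u) = 0) →
      IsPreconnected Z ∨ UnboundedThroughEveryPoint Z := by
    intro d₀ d₁ d₂ d₃ a₀ a₁ a₂ a₃ Z h₁ h₂ h₃ hZ
    have hset : Z = {u | expSum ![d₁, d₂, d₃]
        ![dotCLM (a₁ - a₀), dotCLM (a₂ - a₀), dotCLM (a₃ - a₀)] u = -d₀} := by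
      ext u
      have e : ∀ b, dotCLM (b - a₀) u = dotCLM b u - dotCLM a₀ u := by
        intro b; simp; ring
      rw [hZ]
      simp only [expSum, Fin.sum_univ_three, mem_ofPred_eq, Matrix.cons_val, e, Real.exp_sub]
      field_simp
      constructor <;> intro h <;> linarith
    rw [hset]
    refine level_expSum_dichotomy ?_ (fun i => ?_) _
    · rw [← Module.finrank_eq_rank]
      simp
    · fin_cases i <;> assumption
  have key22 : ∀ {d₁ d₂ d₃ d₄ : ℝ} {i j k l : Fin 4} {Z : Set (ℝ × ℝ)}, i ≠ j →
      0 < d₁ → 0 < d₂ → d₃ < 0 → d₄ < 0 →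
      (∀ u, u ∈ Z ↔ d₁ * Real.exp (dotCLM (a i) u) + d₂ * Real.exp (dotCLM (a j) u) +
        d₃ * Real.exp (dotCLM (a k) u) + d₄ * Real.exp (dotCLM (a l) u) = 0) →
      IsPreconnected Z ∨ UnboundedThroughEveryPoint Z := by
    intro d₁ d₂ d₃ d₄ i j k l Z hij h₁ h₂ h₃ h₄ hZ
    have hset : Z = {u | d₁ * Real.exp (dotCLM (a i) u) + d₂ * Real.exp (dotCLM (a j) u) =
        -d₃ * Real.exp (dotCLM (a k) u) + -d₄ * Real.exp (dotCLM (a l) u)} := by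
      ext u
      rw [hZ, mem_ofPred_eq]
      constructor <;> intro h <;> linarith
    rw [hset]
    exact .inr (unboundedThroughEveryPoint_two_add_two h₁ h₂ (neg_pos.2 h₃) (neg_pos.2 h₄)
      (ha.ne hij))
  -- By symmetry under `c ↦ -c`, the first coefficient may be taken positive.
  wlog h0 : 0 < c 0 generalizing c
  · have h := this (c := -c) (fun i => neg_ne_zero.2 (hc i))
      (neg_pos.2 ((not_lt.1 h0).lt_of_ne (hc 0)))
    simpa only [Pi.neg_apply, neg_mul, Finset.sum_neg_distrib, neg_eq_zero] using h
  simp only [Fin.sum_univ_four]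
  rcases (hc 1).lt_or_gt with h1 | h1 <;> rcases (hc 2).lt_or_gt with h2 | h2 <;>
    rcases (hc 3).lt_or_gt with h3 | h3
  · refine key13 (d₀ := -c 0) (a₀ := a 0) (a₁ := a 1) (a₂ := a 2) (a₃ := a 3) (neg_pos.2 h1)
      (neg_pos.2 h2) (neg_pos.2 h3) fun u => ?_
    rw [mem_ofPred_eq]
    constructor <;> intro h <;> linarith
  · refine key22 (i := 0) (j := 3) (k := 1) (l := 2) (by decide) h0 h3 h1 h2
      fun u => ?_
    rw [mem_ofPred_eq]
    constructor <;> intro h <;> linarith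
  · refine key22 (i := 0) (j := 2) (k := 1) (l := 3) (by decide) h0 h2 h1 h3
      fun u => ?_
    rw [mem_ofPred_eq]
    constructor <;> intro h <;> linarith
  · refine key13 (d₀ := c 1) (a₀ := a 1) (a₁ := a 0) (a₂ := a 2) (a₃ := a 3) h0 h2 h3
      fun u => ?_
    rw [mem_ofPred_eq]
    constructor <;> intro h <;> linarith
  · refine key22 (i := 0) (j := 1) (k := 2) (l := 3) (by decide) h0 h1 h2 h3
      fun u => ?_
    rw [mem_ofPred_eq]
  · refine key13 (d₀ := c 2) (a₀ := a 2) (a₁ := a 0) (a₂ := a 1) (a₃ := a 3) h0 h1 h3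
      fun u => ?_
    rw [mem_ofPred_eq]
    constructor <;> intro h <;> linarith
  · exact key13 (d₀ := c 3) (a₀ := a 3) (a₁ := a 0) (a₂ := a 1) (a₃ := a 2) h0 h1 h2
      fun u => Iff.rfl
  · exact key13 (d₀ := c 3) (a₀ := a 3) (a₁ := a 0) (a₂ := a 1) (a₃ := a 2) h0 h1 h2
      fun u => Iff.rfl

/-- Compact connected components of a subset of the open quadrant coincide as soon as the set, in
logarithmic coordinates, is preconnected or unbounded through every point. -/
theorem connectedComponentIn_eq_of_log {Z : Set (ℝ × ℝ)} (hZ : ∀ x ∈ Z, 0 < x.1 ∧ 0 < x.2)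
    (h : IsPreconnected {u : ℝ × ℝ | (Real.exp u.1, Real.exp u.2) ∈ Z} ∨
      UnboundedThroughEveryPoint {u : ℝ × ℝ | (Real.exp u.1, Real.exp u.2) ∈ Z})
    {x y : ℝ × ℝ} (hx : x ∈ Z) (hy : y ∈ Z) (hK : IsCompact (connectedComponentIn Z x)) :
    connectedComponentIn Z x = connectedComponentIn Z y := by
  have hE : Continuous fun u : ℝ × ℝ => (Real.exp u.1, Real.exp u.2) := by fun_prop
  have hlog : ∀ z ∈ Z, (Real.exp (Real.log z.1), Real.exp (Real.log z.2)) = z := fun z hz =>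
    Prod.ext (Real.exp_log (hZ z hz).1) (Real.exp_log (hZ z hz).2)
  rcases h with h | h
  · have himage : (fun u : ℝ × ℝ => (Real.exp u.1, Real.exp u.2)) ''
        {u : ℝ × ℝ | (Real.exp u.1, Real.exp u.2) ∈ Z} = Z := by
      refine Subset.antisymm (image_subset_iff.2 fun u hu => hu) fun z hz => ?_
      refine ⟨(Real.log z.1, Real.log z.2), ?_, hlog z hz⟩
      rw [mem_ofPred_eq, hlog z hz]
      exact hz
    have hpre : IsPreconnected Z := himage ▸ h.image _ hE.continuousOn
    rw [hpre.connectedComponentIn hx, hpre.connectedComponentIn hy]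
  · obtain ⟨S, hS, hxS, hpre, hunb⟩ := h (Real.log x.1, Real.log x.2)
      (by rw [mem_ofPred_eq, hlog x hx]; exact hx)
    refine absurd ?_ hunb
    have hsub : (fun u : ℝ × ℝ => (Real.exp u.1, Real.exp u.2)) '' S ⊆ connectedComponentIn Z x :=
      (hpre.image _ hE.continuousOn).subset_connectedComponentIn ⟨_, hxS, hlog x hx⟩
        (image_subset_iff.2 hS)
    have hcont : ContinuousOn (fun z : ℝ × ℝ => (Real.log z.1, Real.log z.2))
        (connectedComponentIn Z x) := by
      intro z hz
      have hz := hZ z (connectedComponentIn_subset Z x hz)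
      exact ((continuousAt_fst.log hz.1.ne').prodMk
        (continuousAt_snd.log hz.2.ne')).continuousWithinAt
    refine (hK.image_of_continuousOn hcont).isBounded.subset fun u hu => ?_
    exact ⟨_, hsub ⟨u, hu, rfl⟩, by simp⟩

/-- The real curve `x₂² - 4x₁³x₂ + x₁⁸ + 3x₁⁴ = 0` is bounded on the half-plane `0 < x₁`. -/
theorem curve_bounds {x : ℝ × ℝ} (h1 : 0 < x.1)
    (h : x.2 ^ 2 - 4 * x.1 ^ 3 * x.2 + x.1 ^ 8 + 3 * x.1 ^ 4 = 0) :
    1 ≤ x.1 ∧ x.1 ≤ 2 ∧ x.2 ≤ 20 := by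
  have h2 : (x.2 - 2 * x.1 ^ 3) ^ 2 = x.1 ^ 4 * ((x.1 ^ 2 - 1) * (3 - x.1 ^ 2)) := by
    linear_combination h
  have h3 : 0 ≤ (x.1 ^ 2 - 1) * (3 - x.1 ^ 2) :=
    nonneg_of_mul_nonneg_right (h2 ▸ sq_nonneg _) (by positivity)
  have h4 : 1 ≤ x.1 ^ 2 := by nlinarith
  have h5 : x.1 ^ 2 ≤ 3 := by nlinarith
  have h6 : x.1 ≤ 2 := by nlinarith
  refine ⟨by nlinarith, h6, ?_⟩
  have h7 : (x.1 ^ 2 - 1) * (3 - x.1 ^ 2) ≤ 1 := by nlinarith [sq_nonneg (x.1 ^ 2 - 2)]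
  have h8 : x.1 ^ 4 ≤ 2 ^ 4 := by gcongr
  have h9 : x.1 ^ 3 ≤ 2 ^ 3 := by gcongr
  have h10 : (x.2 - 2 * x.1 ^ 3) ^ 2 ≤ 4 ^ 2 := by
    rw [h2]
    nlinarith [pow_pos h1 4]
  linarith [abs_le_of_sq_le_sq' h10 (by norm_num)]

/-- The zero set in the positive quadrant of a bivariate 4-nomial has at most
one compact connected component, and the bound is attained: for
`f(x₁,x₂) = x₂² - 4x₁³x₂ + x₁⁸ + 3x₁⁴` the zero set in the positive quadrant
is nonempty and compact (hence is itself a compact connected component by the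
first part). -/
theorem four_nomial_at_most_one_compact_component_and_attained :
    (∀ (c : Fin 4 → ℝ) (a : Fin 4 → ℝ × ℝ), (∀ i, c i ≠ 0) →
      Function.Injective a →
      ∀ (f : ℝ × ℝ → ℝ),
        (∀ x : ℝ × ℝ, f x = ∑ i, c i * (x.1 ^ (a i).1 * x.2 ^ (a i).2)) →
      ∀ Z : Set (ℝ × ℝ), Z = {x : ℝ × ℝ | 0 < x.1 ∧ 0 < x.2 ∧ f x = 0} →
      ∀ x ∈ Z, ∀ y ∈ Z,
        IsCompact (connectedComponentIn Z x) →
        IsCompact (connectedComponentIn Z y) →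
        connectedComponentIn Z x = connectedComponentIn Z y) ∧
    ({x : ℝ × ℝ | 0 < x.1 ∧ 0 < x.2 ∧
        x.2 ^ 2 - 4 * x.1 ^ 3 * x.2 + x.1 ^ 8 + 3 * x.1 ^ 4 = 0}.Nonempty ∧
     IsCompact {x : ℝ × ℝ | 0 < x.1 ∧ 0 < x.2 ∧
        x.2 ^ 2 - 4 * x.1 ^ 3 * x.2 + x.1 ^ 8 + 3 * x.1 ^ 4 = 0}) := by
  refine ⟨?_, ⟨(1, 2), by norm_num⟩, ?_⟩
  · rintro c a hc ha f hf Z rfl x hx y hy hK -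
    refine connectedComponentIn_eq_of_log (fun z hz => ⟨hz.1, hz.2.1⟩) ?_ hx hy hK
    convert isPreconnected_or_unboundedThroughEveryPoint hc ha using 2 <;>
    · ext u
      simp only [mem_ofPred_eq, Real.exp_pos, true_and, hf, ← Real.exp_mul, ← Real.exp_add,
        dotCLM_apply, mul_comm]
  · have hset : {x : ℝ × ℝ | 0 < x.1 ∧ 0 < x.2 ∧
        x.2 ^ 2 - 4 * x.1 ^ 3 * x.2 + x.1 ^ 8 + 3 * x.1 ^ 4 = 0} =
        (Icc 1 2 ×ˢ Icc 0 20) ∩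
          {x : ℝ × ℝ | x.2 ^ 2 - 4 * x.1 ^ 3 * x.2 + x.1 ^ 8 + 3 * x.1 ^ 4 = 0} := by
      ext x
      constructor
      · rintro ⟨h1, h2, h⟩
        obtain ⟨h3, h4, h5⟩ := curve_bounds h1 h
        exact ⟨⟨⟨h3, h4⟩, h2.le, h5⟩, h⟩
      · rintro ⟨⟨⟨h3, h4⟩, h2, h5⟩, h⟩
        have h1 : 0 < x.1 := zero_lt_one.trans_le h3
        refine ⟨h1, h2.lt_of_ne fun h0 => ?_, h⟩
        rw [mem_ofPred_eq, ← h0] at h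
        have : 0 < x.1 ^ 8 + 3 * x.1 ^ 4 := by positivity
        linarith
    rw [hset]
    exact (isCompact_Icc.prod isCompact_Icc).inter_right
      (isClosed_eq (by fun_prop) continuous_const)
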